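/- Let ℒ_n be the set of matrices L with rows indexed by triples 1 ≤ i < j < k ≤ n and columns indexed by pairs 1 ≤ i < j ≤ n over a field K, such that: the row (i,j,k) is supported on columns (j,k), (i,k), (i,j); each row is nonzero; and each row sums to zero. Then every L ∈ ℒ_n has rank at least (n-1)(n-2)/2. -/

import Mathlib

open Finset

theorem card_pairs_lt_mul_two (n : ℕ) :
    Fintype.card {p : Fin n × Fin n // p.1 < p.2} * 2 = n * (n - 1) := by
  rw [Fintype.card_subtype, Finset.card_filter, Fintype.sum_prod_type_right]
  have h (y : Fin n) : (∑ x : Fin n, if x < y then 1 else 0) = (y : ℕ) := by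
    rw [← Finset.card_filter, ← Fin.card_Iio y]
    congr 1
    ext x
    simp
  simp only [h]
  rw [Fin.sum_univ_eq_sum_range (fun i => i) n, Finset.sum_range_id_mul_two]

theorem mul_eq_mul_of_nontrivial_relation {K : Type*} [Field K] {a b v₁ v₂ w₁ w₂ : K}
    (hab : a ≠ 0 ∨ b ≠ 0) (hv : a * v₁ + b * v₂ = 0) (hw : a * w₁ + b * w₂ = 0) :
    v₁ * w₂ = v₂ * w₁ := by
  rcases hab with ha | hb
  · apply mul_left_cancel₀ ha
    linear_combination w₂ * hv - v₂ * hw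
  · apply mul_left_cancel₀ hb
    linear_combination v₁ * hw - w₁ * hv

/-- The vectors in `V` that vanish on every pair whose larger element is less than `m`. -/
def vanishingBelow {K : Type*} [Field K] {n : ℕ}
    (V : Submodule K ({p : Fin n × Fin n // p.1 < p.2} → K)) (m : ℕ) :
    Submodule K ({p : Fin n × Fin n // p.1 < p.2} → K) where
  carrier := {f | f ∈ V ∧ ∀ p, (p.1.2 : ℕ) < m → f p = 0}
  add_mem' := fun hf hg => ⟨V.add_mem hf.1 hg.1, fun p hp => by simp [hf.2 p hp, hg.2 p hp]⟩
  zero_mem' := ⟨V.zero_mem, fun _ _ => rfl⟩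
  smul_mem' := fun c _ hf => ⟨V.smul_mem c hf.1, fun p hp => by simp [hf.2 p hp]⟩

section

variable {K : Type*} [Field K] {n : ℕ}

theorem finrank_vanishingBelow_le_succ
    (V : Submodule K ({p : Fin n × Fin n // p.1 < p.2} → K)) (m : ℕ)
    (hV : ∀ v ∈ vanishingBelow V m, ∀ w ∈ vanishingBelow V m,
      ∀ p q : {p : Fin n × Fin n // p.1 < p.2}, (p.1.2 : ℕ) = m → (q.1.2 : ℕ) = m →
        v p * w q = v q * w p) :
    Module.finrank K (vanishingBelow V m) ≤ Module.finrank K (vanishingBelow V (m + 1)) + 1 := by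
  by_cases h : ∃ v ∈ vanishingBelow V m, ∃ p, (p.1.2 : ℕ) = m ∧ v p ≠ 0
  · obtain ⟨v, hv, p, hp, hvp⟩ := h
    have hle : vanishingBelow V m ≤ vanishingBelow V (m + 1) ⊔ Submodule.span K {v} := by
      intro w hw
      rw [Submodule.mem_sup]
      refine ⟨w - (w p / v p) • v, ⟨V.sub_mem hw.1 (V.smul_mem _ hv.1), fun q hq => ?_⟩,
        (w p / v p) • v, Submodule.smul_mem _ _ (Submodule.mem_span_singleton_self v), by simp⟩
      rcases Nat.lt_succ_iff_lt_or_eq.mp hq with hq | hq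
      · simp [hv.2 q hq, hw.2 q hq]
      · have := hV v hv w hw p q hp hq
        simp only [Pi.sub_apply, Pi.smul_apply, smul_eq_mul]
        field_simp
        linear_combination this
    have hsup := Submodule.finrank_add_le_finrank_add_finrank (vanishingBelow V (m + 1))
      (Submodule.span K {v})
    have hspan : Module.finrank K (Submodule.span K {v}) ≤ 1 := by
      simpa using finrank_span_le_card (R := K) ({v} : Set _)
    have := Submodule.finrank_mono hle
    omega
  · push Not at h
    have hle : vanishingBelow V m ≤ vanishingBelow V (m + 1) := fun w hw =>
      ⟨hw.1, fun q hq => (Nat.lt_succ_iff_lt_or_eq.mp hq).elim (hw.2 q) (h w hw q)⟩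
    exact (Submodule.finrank_mono hle).trans (Nat.le_succ _)

theorem finrank_le_of_vanishingBelow
    (V : Submodule K ({p : Fin n × Fin n // p.1 < p.2} → K))
    (hV : ∀ m, ∀ v ∈ vanishingBelow V m, ∀ w ∈ vanishingBelow V m,
      ∀ p q : {p : Fin n × Fin n // p.1 < p.2}, (p.1.2 : ℕ) = m → (q.1.2 : ℕ) = m →
        v p * w q = v q * w p) :
    Module.finrank K V ≤ n - 1 := by
  have hone : V ≤ vanishingBelow V 1 := fun f hf =>
    ⟨hf, fun p hp => absurd (Fin.lt_def.mp p.2) (by omega)⟩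
  have hind (d : ℕ) : Module.finrank K (vanishingBelow V 1) ≤
      Module.finrank K (vanishingBelow V (d + 1)) + d := by
    induction d with
    | zero => simp
    | succ d ih =>
      have := finrank_vanishingBelow_le_succ V (d + 1) (hV (d + 1))
      omega
  have hbot : vanishingBelow V (n - 1 + 1) = ⊥ := by
    rw [eq_bot_iff]
    intro f hf
    rw [Submodule.mem_bot]
    ext p
    exact hf.2 p (by omega)
  have h := hind (n - 1)
  rw [hbot, finrank_bot, zero_add] at h
  exact (Submodule.finrank_mono hone).trans h

end

theorem sum_triangle_row {K : Type*} [Field K] {n : ℕ}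
    (r g : {p : Fin n × Fin n // p.1 < p.2} → K) {i j k : Fin n} (hij : i < j) (hjk : j < k)
    (hr : ∀ p, r p ≠ 0 → (p : Fin n × Fin n) = (j, k) ∨ (p : Fin n × Fin n) = (i, k) ∨
      (p : Fin n × Fin n) = (i, j)) :
    ∑ p, r p * g p = r ⟨(j, k), hjk⟩ * g ⟨(j, k), hjk⟩ +
      r ⟨(i, k), hij.trans hjk⟩ * g ⟨(i, k), hij.trans hjk⟩ +
      r ⟨(i, j), hij⟩ * g ⟨(i, j), hij⟩ := by
  rw [← Finset.sum_subset (Finset.subset_univ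
    {⟨(j, k), hjk⟩, ⟨(i, k), hij.trans hjk⟩, ⟨(i, j), hij⟩})]
  · rw [Finset.sum_insert, Finset.sum_pair, add_assoc]
    · simp [hjk.ne']
    · simp [hij.ne', hjk.ne']
  · intro p _ hp
    by_contra h
    apply hp
    simpa [Subtype.ext_iff] using hr p (left_ne_zero_of_mul h)

/-- Every matrix in `ℒ_n` (rows indexed by triples `i<j<k`, columns by pairs `i<j`, row
`(i,j,k)` supported on columns `(j,k)`, `(i,k)`, `(i,j)`, each row nonzero with zero sum)
has rank at least `(n-1)(n-2)/2`. -/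
theorem rank_lower_bound
    (K : Type*) [Field K] (n : ℕ) (hn : 3 ≤ n)
    (L : Matrix {q : Fin n × Fin n × Fin n // q.1 < q.2.1 ∧ q.2.1 < q.2.2}
        {p : Fin n × Fin n // p.1 < p.2} K)
    (hsupp : ∀ q p, L q p ≠ 0 →
      (p : Fin n × Fin n) = (q.1.2.1, q.1.2.2) ∨
      (p : Fin n × Fin n) = (q.1.1, q.1.2.2) ∨
      (p : Fin n × Fin n) = (q.1.1, q.1.2.1))
    (hnonzero : ∀ q, ∃ p, L q p ≠ 0)
    (hsum : ∀ q, ∑ p, L q p = 0) :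
    (n - 1) * (n - 2) / 2 ≤ L.rank := by
  have hrel (i j k : Fin n) (hij : i < j) (hjk : j < k) : ∃ a b c : K, (a ≠ 0 ∨ b ≠ 0) ∧
      ∀ f ∈ LinearMap.ker L.mulVecLin, a * f ⟨(i, k), hij.trans hjk⟩ + b * f ⟨(j, k), hjk⟩ +
        c * f ⟨(i, j), hij⟩ = 0 := by
    let q : {q : Fin n × Fin n × Fin n // q.1 < q.2.1 ∧ q.2.1 < q.2.2} := ⟨(i, j, k), hij, hjk⟩
    refine ⟨L q ⟨(i, k), hij.trans hjk⟩, L q ⟨(j, k), hjk⟩, L q ⟨(i, j), hij⟩, ?_, ?_⟩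
    · by_contra! h
      have hc : L q ⟨(i, j), hij⟩ = 0 := by
        have hs := sum_triangle_row (L q) (fun _ => 1) hij hjk (hsupp q)
        simp only [mul_one, hsum q, h.1, h.2, zero_add] at hs
        exact hs.symm
      obtain ⟨p, hp⟩ := hnonzero q
      obtain ⟨p', hp'⟩ := p
      rcases hsupp q _ hp with rfl | rfl | rfl
      exacts [hp h.2, hp h.1, hp hc]
    · intro f hf
      have hs := sum_triangle_row (L q) f hij hjk (hsupp q)
      have h0 : ∑ p, L q p * f p = 0 := congrFun (LinearMap.mem_ker.mp hf) q
      rw [h0] at hs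
      linear_combination -hs
  have hminor (m : ℕ) (v) (hv : v ∈ vanishingBelow (LinearMap.ker L.mulVecLin) m)
      (w) (hw : w ∈ vanishingBelow (LinearMap.ker L.mulVecLin) m) (i j k : Fin n) (hij : i < j)
      (hjk : j < k) (hk : (k : ℕ) = m) : v ⟨(i, k), hij.trans hjk⟩ * w ⟨(j, k), hjk⟩ =
        v ⟨(j, k), hjk⟩ * w ⟨(i, k), hij.trans hjk⟩ := by
    obtain ⟨a, b, c, hab, h⟩ := hrel i j k hij hjk
    have hjm : (j : ℕ) < m := hk ▸ hjk
    refine mul_eq_mul_of_nontrivial_relation hab ?_ ?_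
    · simpa [hv.2 ⟨(i, j), hij⟩ hjm] using h v hv.1
    · simpa [hw.2 ⟨(i, j), hij⟩ hjm] using h w hw.1
  have hker : Module.finrank K (LinearMap.ker L.mulVecLin) ≤ n - 1 := by
    refine finrank_le_of_vanishingBelow _ fun m v hv w hw p q hp hq => ?_
    obtain ⟨⟨i, k⟩, hik⟩ := p
    obtain ⟨⟨j, k'⟩, hjk⟩ := q
    obtain rfl : k = k' := Fin.ext (hp.trans hq.symm)
    rcases lt_trichotomy i j with hij | rfl | hji
    · exact hminor m v hv w hw i j k hij hjk hp
    · rfl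
    · exact (hminor m v hv w hw j i k hji hik hp).symm
  have hrank := LinearMap.finrank_range_add_finrank_ker L.mulVecLin
  rw [Module.finrank_fintype_fun_eq_card] at hrank
  have hcard := card_pairs_lt_mul_two n
  change L.rank + _ = _ at hrank
  obtain ⟨t, rfl⟩ : ∃ t, n = t + 2 := ⟨n - 2, by omega⟩
  simp only [Nat.add_sub_cancel, show t + 2 - 1 = t + 1 by omega] at *
  have : (t + 2) * (t + 1) = (t + 1) * t + 2 * (t + 1) := by ring
  omega
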